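/- Let p, q ∈ ℕ, let G : ℝ^{p+q} → ℝ be an analytic function, and let Z be an ℝ^q-valued random variable on a probability space that is supported on a compact set. Then the function ℝ^p → ℝ, x ↦ E[G(x, Z)], is analytic. -/

import Mathlib

open MeasureTheory Set

open scoped NNReal ENNReal

namespace FormalMultilinearSeries

/-- The coefficients of `p.changeOrigin w` are bounded, uniformly for `‖w‖ ≤ r`, by the
coefficients of a series converging at `r'` as soon as `r + r'` is below the radius of `p`. -/
theorem exists_summable_norm_changeOrigin_le {𝕜 E F : Type*} [NontriviallyNormedField 𝕜]
    [NormedAddCommGroup E] [NormedSpace 𝕜 E] [NormedAddCommGroup F] [NormedSpace 𝕜 F]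
    [CompleteSpace F] (p : FormalMultilinearSeries 𝕜 E F) {r r' : ℝ≥0}
    (h : (r + r' : ℝ≥0∞) < p.radius) :
    ∃ M : ℕ → ℝ, Summable (fun n ↦ M n * (r' : ℝ) ^ n) ∧
      ∀ w : E, ‖w‖ ≤ r → ∀ n, ‖p.changeOrigin w n‖ ≤ M n := by
  have hr : (r : ℝ≥0∞) < p.radius := lt_of_le_of_lt le_self_add h
  refine ⟨fun n ↦ ((∑' s : Σ l : ℕ, {s : Finset (Fin (n + l)) // s.card = l},
    ‖p (n + s.1)‖₊ * r ^ s.1 : ℝ≥0) : ℝ), ?_, fun w hw n ↦ ?_⟩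
  · have := (NNReal.summable_sigma.1 (p.changeOriginSeries_summable_aux₁ h)).2
    simp only [NNReal.tsum_mul_right] at this
    beta_reduce
    exact_mod_cast this
  · have hw' : ‖w‖₊ ≤ r := hw
    have hwr : (‖w‖₊ : ℝ≥0∞) < p.radius := lt_of_le_of_lt (by exact_mod_cast hw') hr
    refine NNReal.coe_le_coe.2 ((p.nnnorm_changeOrigin_le n hwr).trans ?_)
    exact (p.changeOriginSeries_summable_aux₂ hwr n).tsum_le_tsum (fun s ↦ by gcongr)
      (p.changeOriginSeries_summable_aux₂ hr n)

end FormalMultilinearSeries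

/-- Power series whose coefficients are dominated by those of one convergent series may be
integrated term by term. -/
theorem hasFPowerSeriesOnBall_integral {α E H : Type*} [MeasurableSpace α] {μ : Measure α}
    [IsFiniteMeasure μ] [NormedAddCommGroup E] [NormedSpace ℝ E] [NormedAddCommGroup H]
    [NormedSpace ℝ H] [CompleteSpace H] {g : α → E → H} {c : α → FormalMultilinearSeries ℝ E H}
    {x : E} {r : ℝ≥0} (hr : 0 < r) {M : ℕ → ℝ}
    (hc : ∀ n, AEStronglyMeasurable (fun a ↦ c a n) μ)
    (hM : ∀ n, ∀ᵐ a ∂μ, ‖c a n‖ ≤ M n) (hsum : Summable fun n ↦ M n * (r : ℝ) ^ n)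
    (hg : ∀ᵐ a ∂μ, ∀ y ∈ Metric.eball (0 : E) r, HasSum (fun n ↦ c a n fun _ ↦ y) (g a (x + y))) :
    HasFPowerSeriesOnBall (fun x' ↦ ∫ a, g a x' ∂μ) (fun n ↦ ∫ a, c a n ∂μ) x r where
  r_le := by
    refine FormalMultilinearSeries.le_radius_of_summable _ (.of_nonneg_of_le
      (fun n ↦ by positivity) (fun n ↦ ?_) (hsum.mul_left (μ.real univ)))
    calc ‖∫ a, c a n ∂μ‖ * (r : ℝ) ^ n ≤ (M n * μ.real univ) * (r : ℝ) ^ n := by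
          gcongr
          exact norm_integral_le_of_norm_le_const (hM n)
      _ = μ.real univ * (M n * (r : ℝ) ^ n) := by ring
  r_pos := by exact_mod_cast hr
  hasSum {y} hy := by
    have hyr : ‖y‖ ≤ r := by
      have : ‖y‖ < r := by simpa using hy
      exact this.le
    have hint n : Integrable (fun a ↦ c a n) μ := .of_bound (hc n) (M n) (hM n)
    have key : HasSum (fun n ↦ ∫ a, (c a n fun _ ↦ y) ∂μ) (∫ a, g a (x + y) ∂μ) := by
      refine hasSum_integral_of_dominated_convergence (fun n _ ↦ M n * (r : ℝ) ^ n)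
        (fun n ↦ ?_) (fun n ↦ ?_) (.of_forall fun _ ↦ hsum) (integrable_const _) ?_
      · exact (ContinuousMultilinearMap.apply ℝ (fun _ : Fin n ↦ E) H
          fun _ ↦ y).continuous.comp_aestronglyMeasurable (hc n)
      · filter_upwards [hM n] with a ha
        calc ‖c a n fun _ ↦ y‖ ≤ ‖c a n‖ * ‖y‖ ^ n := by
              simpa using (c a n).le_opNorm fun _ ↦ y
          _ ≤ M n * (r : ℝ) ^ n := by
              have := (norm_nonneg _).trans ha
              gcongr
      · filter_upwards [hg] with a ha using ha y hy
    simpa only [ContinuousMultilinearMap.integral_apply (hint _)] using key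

/-- If `G` is analytic at `(x, z)`, then `x' ↦ ∫ w in T, G (x', w) ∂μ` is analytic at `x` for all
measurable sets `T` in a fixed neighbourhood of `z`. -/
theorem AnalyticAt.exists_analyticAt_setIntegral {E F H : Type*} [NormedAddCommGroup E]
    [NormedSpace ℝ E] [NormedAddCommGroup F] [NormedSpace ℝ F] [SecondCountableTopology F]
    [MeasurableSpace F] [OpensMeasurableSpace F] [NormedAddCommGroup H] [NormedSpace ℝ H]
    [CompleteSpace H] (μ : Measure F) [IsFiniteMeasure μ] {G : E × F → H} {x : E} {z : F}
    (hG : AnalyticAt ℝ G (x, z)) :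
    ∃ ε > 0, ∀ T ⊆ Metric.closedBall z ε, MeasurableSet T →
      AnalyticAt ℝ (fun x' ↦ ∫ w in T, G (x', w) ∂μ) x := by
  obtain ⟨p, R, hp⟩ := hG
  obtain ⟨s, hs0, hsR⟩ := ENNReal.lt_iff_exists_nnreal_btwn.1 hp.r_pos
  set r : ℝ≥0 := s / 2 with hr_def
  have hr : 0 < r := half_pos (by exact_mod_cast hs0)
  have hrR : (r + r : ℝ≥0∞) < R := by
    rw [← ENNReal.coe_add, hr_def, add_halves]
    exact hsR
  obtain ⟨M, hMs, hM⟩ := p.exists_summable_norm_changeOrigin_le (hrR.trans_le hp.r_le)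
  refine ⟨r, hr, fun T hT hTm ↦ ?_⟩
  have hmem : ∀ w ∈ T, ‖((0 : E), w - z)‖ ≤ r := fun w hw ↦ by
    have := hT hw
    rw [mem_closedBall_iff_norm] at this
    simpa [Prod.norm_def] using this
  have hlt : ∀ w ∈ T, (‖((0 : E), w - z)‖₊ : ℝ≥0∞) ≤ r := fun w hw ↦ by
    have : ‖((0 : E), w - z)‖₊ ≤ r := hmem w hw
    exact_mod_cast this
  have hrR' : (r : ℝ≥0∞) < R := lt_of_le_of_lt le_self_add hrR
  let c : F → FormalMultilinearSeries ℝ E H := fun w ↦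
    (p.changeOrigin (0, w - z)).compContinuousLinearMap (.inl ℝ E F)
  refine (hasFPowerSeriesOnBall_integral (c := c) (M := M) (r := r) hr (fun n ↦ ?_)
    (fun n ↦ ?_) hMs ?_).analyticAt
  · refine ContinuousOn.aestronglyMeasurable ?_ hTm
    refine (ContinuousMultilinearMap.compContinuousLinearMapL
      fun _ : Fin n ↦ ContinuousLinearMap.inl ℝ E F).continuous.comp_continuousOn ?_
    refine (p.hasFPowerSeriesOnBall_changeOrigin n
      (hp.r_pos.trans_le hp.r_le)).continuousOn.comp (by fun_prop) fun w hw ↦ ?_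
    rw [mem_eball_zero_iff]
    exact (hlt w hw).trans_lt (hrR'.trans_le hp.r_le)
  · filter_upwards [ae_restrict_mem hTm] with w hw
    refine le_trans ?_ (hM _ (hmem w hw) n)
    refine ((p.changeOrigin (0, w - z) n).norm_compContinuousLinearMap_le _).trans ?_
    refine mul_le_of_le_one_right (norm_nonneg _) (Finset.prod_le_one (by simp) fun _ _ ↦ ?_)
    exact ContinuousLinearMap.norm_inl_le_one ℝ E F
  · filter_upwards [ae_restrict_mem hTm] with w hw y hy
    have h := (hp.changeOrigin ((hlt w hw).trans_lt hrR')).hasSum (y := (y, 0)) ?_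
    · simpa [c, Function.comp_def] using h
    · have hy' : ‖((y, 0) : E × F)‖ₑ < r := by
        have : ‖((y, 0) : E × F)‖₊ = ‖y‖₊ := by simp [Prod.nnnorm_def]
        rw [enorm_eq_nnnorm, this]
        exact mem_eball_zero_iff.1 hy
      rw [mem_eball_zero_iff]
      refine hy'.trans_le (ENNReal.le_sub_of_add_le_left (by simp) ?_)
      exact (add_le_add_left (hlt w hw) _).trans hrR.le

/-- Integrating out one variable of an analytic function over a compact set preserves
analyticity in the other variable. -/
theorem IsCompact.analyticAt_setIntegral {E F H : Type*} [NormedAddCommGroup E]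
    [NormedSpace ℝ E] [NormedAddCommGroup F] [NormedSpace ℝ F] [ProperSpace F]
    [MeasurableSpace F] [OpensMeasurableSpace F] [NormedAddCommGroup H]
    [NormedSpace ℝ H] [CompleteSpace H] (μ : Measure F) [IsFiniteMeasure μ] {G : E × F → H}
    (hG : ∀ z, AnalyticAt ℝ G z) {K : Set F} (hK : IsCompact K) (x : E) :
    AnalyticAt ℝ (fun x' ↦ ∫ w in K, G (x', w) ∂μ) x := by
  have hcont : Continuous G := continuous_iff_continuousAt.2 fun z ↦ (hG z).continuousAt
  have hint (x' : E) {T : Set F} (hT : T ⊆ K) : IntegrableOn (fun w ↦ G (x', w)) T μ :=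
    ((hcont.comp (by fun_prop : Continuous fun w : F ↦ (x', w))).continuousOn.integrableOn_compact
      hK).mono_set hT
  suffices h : ∃ U ⊇ K, MeasurableSet U ∧ ∀ T ⊆ U ∩ K, MeasurableSet T →
      AnalyticAt ℝ (fun x' ↦ ∫ w in T, G (x', w) ∂μ) x by
    obtain ⟨U, hKU, -, hU⟩ := h
    exact hU K (subset_inter hKU subset_rfl) hK.measurableSet
  refine hK.induction_on (p := fun S ↦ ∃ U ⊇ S, MeasurableSet U ∧ ∀ T ⊆ U ∩ K, MeasurableSet T →
      AnalyticAt ℝ (fun x' ↦ ∫ w in T, G (x', w) ∂μ) x) ?_ ?_ ?_ ?_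
  · refine ⟨∅, subset_rfl, .empty, fun T hT _ ↦ ?_⟩
    obtain rfl : T = ∅ := by simpa using hT
    simpa using analyticAt_const
  · rintro S S' hS ⟨U, hU, h⟩
    exact ⟨U, hS.trans hU, h⟩
  · rintro S S' ⟨U, hSU, hUm, hU⟩ ⟨V, hSV, hVm, hV⟩
    refine ⟨U ∪ V, union_subset_union hSU hSV, hUm.union hVm, fun T hT hTm ↦ ?_⟩
    have hTK : T ⊆ K := hT.trans inter_subset_right
    have h₁ := hU (T ∩ U) (fun w hw ↦ ⟨hw.2, hTK hw.1⟩) (hTm.inter hUm)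
    have h₂ := hV (T \ U) (fun w hw ↦ ⟨(hT hw.1).1.resolve_left hw.2, hTK hw.1⟩) (hTm.diff hUm)
    refine (h₁.add h₂).congr (.of_forall fun x' ↦ ?_)
    exact integral_inter_add_sdiff hUm (hint x' hTK)
  · intro z _
    obtain ⟨ε, hε, h⟩ := (hG (x, z)).exists_analyticAt_setIntegral μ
    exact ⟨Metric.closedBall z ε, mem_nhdsWithin_of_mem_nhds (Metric.closedBall_mem_nhds z hε),
      _, subset_rfl, Metric.isClosed_closedBall.measurableSet,
      fun T hT hTm ↦ h T (hT.trans inter_subset_left) hTm⟩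

/-- Dereich–Kassing, key step in the proof of Theorem 3.
If `G : ℝ^{p+q} → ℝ` is analytic and `Z` is a compactly supported
`ℝ^q`-valued random variable, then `x ↦ E[G(x, Z)]` is analytic. -/
theorem expectation_of_analytic_is_analytic
    (p q : ℕ) (G : (Fin p → ℝ) × (Fin q → ℝ) → ℝ)
    (hG : ∀ z, AnalyticAt ℝ G z)
    {Ω : Type*} [MeasurableSpace Ω] (P : Measure Ω) [IsProbabilityMeasure P]
    (Z : Ω → (Fin q → ℝ)) (hZ : Measurable Z)
    (K : Set (Fin q → ℝ)) (hK : IsCompact K) (hsupp : ∀ᵐ ω ∂P, Z ω ∈ K) :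
    ∀ x : Fin p → ℝ, AnalyticAt ℝ (fun x' => ∫ ω, G (x', Z ω) ∂P) x := by
  intro x
  have hcont : Continuous G := continuous_iff_continuousAt.2 fun z ↦ (hG z).continuousAt
  have := Measure.isProbabilityMeasure_map (μ := P) hZ.aemeasurable
  have hK' : ∀ᵐ w ∂P.map Z, w ∈ K := (ae_map_iff hZ.aemeasurable hK.measurableSet).2 hsupp
  refine (hK.analyticAt_setIntegral (P.map Z) hG x).congr (.of_forall fun x' ↦ ?_)
  have hx' : Continuous fun w ↦ G (x', w) := by fun_prop
  change ∫ w in K, G (x', w) ∂P.map Z = ∫ ω, G (x', Z ω) ∂P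
  rw [Measure.restrict_eq_self_of_ae_mem hK',
    integral_map hZ.aemeasurable hx'.aestronglyMeasurable]
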